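/- Let (w₁, w₂) ∈ A_{\vec P} be a bilinear Muckenhoupt weight pair for exponents p₁ = p₂ = 2 (so p = 1). Then there exists δ > 0 such that (w₁^{1+δ}, w₂^{1+δ}) ∈ A_{\vec P}. -/

import Mathlib

open MeasureTheory Set
open scoped ENNReal

/-- An axis-parallel cube in `ℝⁿ` with lower corner `a` and side length `h`. -/
def axisCube (n : ℕ) (a : Fin n → ℝ) (h : ℝ) : Set (EuclideanSpace ℝ (Fin n)) :=
  {x | ∀ i, x i ∈ Icc (a i) (a i + h)}

/-- The bilinear Muckenhoupt condition `A_{\vec P}` for `\vec P = (2,2)` (so `p = 1`):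
`sup_Q (|Q|⁻¹∫_Q (w₁w₂)^{1/2}) (|Q|⁻¹∫_Q w₁⁻¹)^{1/2} (|Q|⁻¹∫_Q w₂⁻¹)^{1/2} < ∞`. -/
def IsBilinearA22 (n : ℕ) (w₁ w₂ : EuclideanSpace ℝ (Fin n) → ℝ) : Prop :=
  ∃ B : ℝ≥0∞, B ≠ ⊤ ∧ ∀ (a : Fin n → ℝ) (h : ℝ), 0 < h →
    ((volume (axisCube n a h))⁻¹ *
        ∫⁻ x in axisCube n a h, ENNReal.ofReal ((w₁ x * w₂ x) ^ (1/2 : ℝ))) *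
      ((volume (axisCube n a h))⁻¹ *
        ∫⁻ x in axisCube n a h, ENNReal.ofReal (w₁ x)⁻¹) ^ (1/2 : ℝ) *
      ((volume (axisCube n a h))⁻¹ *
        ∫⁻ x in axisCube n a h, ENNReal.ofReal (w₂ x)⁻¹) ^ (1/2 : ℝ) ≤ B

lemma bellman_pointwise {δ N X S x s : ℝ} (hδ0 : 0 < δ) (hδ1 : δ ≤ 1)
    (hX : 0 < X) (hS : 0 < S) (hx : 0 < x) (hs : 0 < s) (hxN : x ≤ N * X) (hsN : s ≤ N * S)
    (hk : 4 * δ * (N + 1) ^ 2 * X ^ (2 + δ) ≤ S ^ 4) :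
    2 * x ^ (1 + δ) - s ^ 4 / x ≤ 2 * X ^ (1 + δ) - S ^ 4 / X +
      (2 * (1 + δ) * X ^ δ + S ^ 4 / X ^ 2) * (x - X) - 4 * S ^ 3 / X * (s - S) := by
  obtain ⟨ξ, rfl⟩ : ∃ ξ, x = X * ξ := ⟨x / X, by field_simp⟩
  obtain ⟨σ, rfl⟩ : ∃ σ, s = S * σ := ⟨s / S, by field_simp⟩
  have hξ : 0 < ξ := pos_of_mul_pos_right hx hX.le
  have hσ : 0 < σ := pos_of_mul_pos_right hs hS.le
  have hξN : ξ ≤ N := by nlinarith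
  have hσN : σ ≤ N := by nlinarith
  have hN : 0 < N := hξ.trans_le hξN
  have hXδ : 0 < X ^ δ := Real.rpow_pos_of_pos hX δ
  have e1 : X ^ (1 + δ) = X * X ^ δ := by rw [Real.rpow_add hX, Real.rpow_one]
  have e2 : X ^ (2 + δ) = X ^ 2 * X ^ δ := by
    rw [Real.rpow_add hX]; norm_cast
  have b1 : ξ ^ (1 + δ) ≤ 1 + (1 + δ) * (ξ - 1) + δ * (ξ - 1) ^ 2 := by
    have := rpow_one_add_le_one_add_mul_self (s := ξ - 1) (by linarith) hδ0.le hδ1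
    rw [add_sub_cancel] at this
    rw [Real.rpow_add hξ, Real.rpow_one]
    nlinarith
  have hG : (ξ - 1) ^ 2 ≤ 2 * (N + 1) ^ 2 * ((σ ^ 2 - ξ) ^ 2 / ξ + 2 * (σ - 1) ^ 2) := by
    have h1 : (σ ^ 2 - ξ) ^ 2 ≤ N * ((σ ^ 2 - ξ) ^ 2 / ξ) := by
      rw [← mul_div_assoc, le_div_iff₀ hξ]
      nlinarith [sq_nonneg (σ ^ 2 - ξ)]
    have h2 : (ξ - 1) ^ 2 ≤ 2 * (σ ^ 2 - ξ) ^ 2 + 2 * ((σ - 1) ^ 2 * (σ + 1) ^ 2) := by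
      nlinarith [sq_nonneg ((ξ - σ ^ 2) - (σ - 1) * (σ + 1))]
    have h3 : (σ - 1) ^ 2 * (σ + 1) ^ 2 ≤ (σ - 1) ^ 2 * (N + 1) ^ 2 := by gcongr
    have h4 : 0 ≤ (σ ^ 2 - ξ) ^ 2 / ξ := by positivity
    have h5 : N * ((σ ^ 2 - ξ) ^ 2 / ξ) ≤ (N + 1) ^ 2 * ((σ ^ 2 - ξ) ^ 2 / ξ) := by
      gcongr; nlinarith
    nlinarith [sq_nonneg ((σ - 1) * (N + 1))]
  have key : 2 * δ * (X * X ^ δ) * (ξ - 1) ^ 2 ≤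
      S ^ 4 / X * ((σ ^ 2 - ξ) ^ 2 / ξ + 2 * (σ - 1) ^ 2) := by
    set G := (σ ^ 2 - ξ) ^ 2 / ξ + 2 * (σ - 1) ^ 2 with hGdef
    have hG0 : 0 ≤ G := by positivity
    calc 2 * δ * (X * X ^ δ) * (ξ - 1) ^ 2
        ≤ 2 * δ * (X * X ^ δ) * (2 * (N + 1) ^ 2 * G) := by gcongr
      _ = (4 * δ * (N + 1) ^ 2 * (X ^ 2 * X ^ δ)) / X * G := by field_simp; ring
      _ ≤ S ^ 4 / X * G := by rw [← e2]; gcongr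
  have e3 : (S * σ) ^ 4 / (X * ξ) = S ^ 4 / X * (1 + 4 * (σ - 1) - (ξ - 1)) +
      S ^ 4 / X * ((σ ^ 2 - ξ) ^ 2 / ξ + 2 * (σ - 1) ^ 2) := by
    field_simp; ring
  have e4 : S ^ 4 / X ^ 2 * (X * ξ - X) = S ^ 4 / X * (ξ - 1) := by field_simp
  have e5 : 4 * S ^ 3 / X * (S * σ - S) = S ^ 4 / X * (4 * (σ - 1)) := by field_simp
  rw [e3, e5, add_mul _ _ (X * ξ - X), e4, Real.mul_rpow hX.le hξ.le, e1]
  have b2 := mul_le_mul_of_nonneg_left b1 (by positivity : 0 ≤ 2 * (X * X ^ δ))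
  nlinarith

lemma bellman_step {ι : Type*} [Fintype ι] [Nonempty ι] {δ X S : ℝ} {x s : ι → ℝ}
    (hδ0 : 0 < δ) (hδ1 : δ ≤ 1) (hx : ∀ i, 0 < x i) (hs : ∀ i, 0 < s i)
    (hX : ∑ i, x i = Fintype.card ι * X) (hS : ∑ i, s i = Fintype.card ι * S)
    (hk : 4 * δ * (Fintype.card ι + 1 : ℝ) ^ 2 * X ^ (2 + δ) ≤ S ^ 4) :
    ∑ i, (2 * x i ^ (1 + δ) - s i ^ 4 / x i) ≤
      Fintype.card ι * (2 * X ^ (1 + δ) - S ^ 4 / X) := by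
  have hc : (0 : ℝ) < Fintype.card ι := by exact_mod_cast Fintype.card_pos
  have hX0 : 0 < X := pos_of_mul_pos_right
    (hX ▸ Finset.sum_pos (fun i _ => hx i) Finset.univ_nonempty) hc.le
  have hS0 : 0 < S := pos_of_mul_pos_right
    (hS ▸ Finset.sum_pos (fun i _ => hs i) Finset.univ_nonempty) hc.le
  refine (Finset.sum_le_sum fun i _ => bellman_pointwise hδ0 hδ1 hX0 hS0 (hx i) (hs i)
    (hX ▸ Finset.single_le_sum (fun j _ => (hx j).le) (Finset.mem_univ i))
    (hS ▸ Finset.single_le_sum (fun j _ => (hs j).le) (Finset.mem_univ i)) hk).trans_eq ?_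
  simp only [Finset.sum_add_distrib, Finset.sum_sub_distrib, ← Finset.mul_sum, hX, hS,
    Finset.sum_const, Finset.card_univ, nsmul_eq_mul]
  ring

section Boxes

variable {n : ℕ}

/-- The half-open axis-parallel box with lower corner `a` and side length `h`. -/
def halfOpenBox (a : Fin n → ℝ) (h : ℝ) : Set (Fin n → ℝ) :=
  univ.pi fun i => Ico (a i) (a i + h)

/-- The lower corner of the dyadic child with index `ε` of the box at `a` with side `h`. -/
noncomputable def childCorner (a : Fin n → ℝ) (h : ℝ) (ε : Fin n → Bool) : Fin n → ℝ :=
  fun i => a i + if ε i then h / 2 else 0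

/-- The mean of a function over a half-open box. -/
noncomputable def boxMean (f : (Fin n → ℝ) → ℝ) (a : Fin n → ℝ) (h : ℝ) : ℝ :=
  (∫ x in halfOpenBox a h, f x) / h ^ n

lemma measurableSet_halfOpenBox (a : Fin n → ℝ) (h : ℝ) : MeasurableSet (halfOpenBox a h) :=
  MeasurableSet.univ_pi fun _ => measurableSet_Ico

lemma volume_halfOpenBox (a : Fin n → ℝ) {h : ℝ} (hh : 0 < h) :
    volume (halfOpenBox a h) = ENNReal.ofReal (h ^ n) := by
  simp [halfOpenBox, Real.volume_pi_Ico, ENNReal.ofReal_pow hh.le]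

lemma iUnion_childBox (a : Fin n → ℝ) {h : ℝ} (hh : 0 < h) :
    ⋃ ε, halfOpenBox (childCorner a h ε) (h / 2) = halfOpenBox a h := by
  ext x
  simp only [halfOpenBox, childCorner, mem_iUnion, mem_pi, mem_univ, mem_Ico, true_imp_iff]
  constructor
  · rintro ⟨ε, hε⟩ i
    have := hε i
    split_ifs at this <;> constructor <;> linarith [this.1, this.2]
  · intro hx
    refine ⟨fun i => decide (a i + h / 2 ≤ x i), fun i => ?_⟩
    have := hx i
    by_cases hi : a i + h / 2 ≤ x i
    · simp only [decide_eq_true hi, ↓reduceIte]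
      constructor <;> linarith [this.2]
    · simp only [hi, decide_false, Bool.false_eq_true, if_false]
      constructor <;> linarith [this.1]

lemma pairwise_disjoint_childBox (a : Fin n → ℝ) (h : ℝ) :
    Pairwise (Function.onFun Disjoint fun ε => halfOpenBox (childCorner a h ε) (h / 2)) := by
  intro ε ε' hne
  refine Set.disjoint_left.2 fun x hx hx' => hne (funext fun i => ?_)
  have h1 := hx i (mem_univ i)
  have h2 := hx' i (mem_univ i)
  simp only [childCorner, mem_Ico] at h1 h2
  cases h3 : ε i <;> cases h4 : ε' i <;> simp [h3, h4] at h1 h2 ⊢ <;> linarith [h1.1, h1.2]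

lemma sum_boxMean_child {f : (Fin n → ℝ) → ℝ} {a : Fin n → ℝ} {h : ℝ} (hh : 0 < h)
    (hf : IntegrableOn f (halfOpenBox a h)) :
    ∑ ε, boxMean f (childCorner a h ε) (h / 2) =
      Fintype.card (Fin n → Bool) * boxMean f a h := by
  have := integral_iUnion_fintype (fun ε => measurableSet_halfOpenBox (childCorner a h ε) (h / 2))
    (pairwise_disjoint_childBox a h) (f := f) (μ := volume)
    (fun ε => hf.mono_set (by
      rw [← iUnion_childBox a hh]
      exact subset_iUnion (fun ε => halfOpenBox (childCorner a h ε) (h / 2)) ε))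
  rw [iUnion_childBox a hh] at this
  simp only [boxMean, ← Finset.sum_div, ← this]
  simp
  field_simp
  rw [mul_assoc, ← mul_pow, div_mul_cancel₀ h two_ne_zero]

section Probability

variable {Ω : Type*} [MeasurableSpace Ω] {μ : Measure Ω} {f g e : Ω → ℝ}

lemma integral_pos_of_forall_pos [NeZero μ] (hf : Integrable f μ) (hpos : ∀ x, 0 < f x) :
    0 < ∫ x, f x ∂μ := by
  rw [integral_pos_iff_support_of_nonneg (fun x => (hpos x).le) hf,
    Function.support_eq_univ fun x => (hpos x).ne']
  exact NeZero.pos (μ univ)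

lemma integrable_rpow_of_le_one [IsFiniteMeasure μ] (hf : Integrable f μ) (hpos : ∀ x, 0 < f x)
    {θ : ℝ} (h0 : 0 ≤ θ) (h1 : θ ≤ 1) : Integrable (fun x => f x ^ θ) μ := by
  refine ((integrable_const (1 : ℝ)).add hf).mono'
    (hf.aemeasurable.pow_const θ).aestronglyMeasurable (.of_forall fun x => ?_)
  rw [Real.norm_of_nonneg (Real.rpow_nonneg (hpos x).le θ)]
  have := rpow_one_add_le_one_add_mul_self (s := f x - 1) (by linarith [hpos x]) h0 h1
  rw [add_sub_cancel] at this
  simp only [Pi.add_apply]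
  nlinarith [hpos x]

lemma integral_rpow_le_rpow_integral [IsProbabilityMeasure μ] (hf : Integrable f μ)
    (hpos : ∀ x, 0 < f x) {θ : ℝ} (h0 : 0 ≤ θ) (h1 : θ ≤ 1) :
    ∫ x, f x ^ θ ∂μ ≤ (∫ x, f x ∂μ) ^ θ := by
  have hX := integral_pos_of_forall_pos hf hpos
  set X := ∫ x, f x ∂μ
  have hpt : ∀ x, f x ^ θ ≤ X ^ θ * (1 - θ + θ / X * f x) := fun x => by
    have := rpow_one_add_le_one_add_mul_self (s := f x / X - 1)
      (by linarith [div_pos (hpos x) hX]) h0 h1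
    rw [add_sub_cancel, Real.div_rpow (hpos x).le hX.le,
      div_le_iff₀' (Real.rpow_pos_of_pos hX θ)] at this
    exact this.trans_eq (by ring)
  calc ∫ x, f x ^ θ ∂μ ≤ ∫ x, X ^ θ * (1 - θ + θ / X * f x) ∂μ :=
        integral_mono (integrable_rpow_of_le_one hf hpos h0 h1)
          (((integrable_const _).add (hf.const_mul _)).const_mul _) hpt
    _ = X ^ θ := by
        rw [integral_const_mul, integral_add (integrable_const _) (hf.const_mul _),
          integral_const_mul]
        simp only [integral_const, probReal_univ, smul_eq_mul, one_mul]
        change X ^ θ * (1 - θ + θ / X * X) = _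
        field_simp
        ring

lemma one_le_integral_rpow_mul [IsProbabilityMeasure μ] {q r θ : ℝ}
    (hf : Integrable f μ) (hg : Integrable g μ) (he : Integrable e μ)
    (hfpos : ∀ x, 0 < f x) (hgpos : ∀ x, 0 < g x) (hepos : ∀ x, 0 < e x)
    (hq : 0 < q) (hr : 0 < r) (h0 : 0 < θ) (h1 : θ ≤ 1)
    (hone : ∀ x, f x * g x ^ q * e x ^ r = 1) :
    1 ≤ (∫ x, f x ^ θ ∂μ) * ((∫ x, g x ∂μ) ^ q * (∫ x, e x ∂μ) ^ r) ^ θ := by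
  have hfθ := integrable_rpow_of_le_one hf hfpos h0.le h1
  have hS := integral_pos_of_forall_pos hfθ fun x => Real.rpow_pos_of_pos (hfpos x) θ
  have hY := integral_pos_of_forall_pos hg hgpos
  have hZ := integral_pos_of_forall_pos he hepos
  set S := ∫ x, f x ^ θ ∂μ with hSdef
  set Y := ∫ x, g x ∂μ with hYdef
  set Z := ∫ x, e x ∂μ with hZdef
  set b : ℝ := (1 + q * θ + r * θ)⁻¹ with hb
  have hb0 : 0 < b := by positivity
  have hsum : b + q * θ * b + r * θ * b = 1 := by rw [hb]; field_simp
  have hpow : ∀ {u v w : ℝ}, 0 < u → 0 < v → 0 < w →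
      (u ^ θ) ^ b * v ^ (q * θ * b) * w ^ (r * θ * b) = (u * v ^ q * w ^ r) ^ (θ * b) := by
    intro u v w hu hv hw
    rw [Real.mul_rpow (by positivity) (by positivity), Real.mul_rpow (by positivity)
      (by positivity), ← Real.rpow_mul hu.le, ← Real.rpow_mul hv.le, ← Real.rpow_mul hw.le]
    ring_nf
  have hpt : ∀ x, (S ^ b * Y ^ (q * θ * b) * Z ^ (r * θ * b))⁻¹ ≤
      b / S * f x ^ θ + q * θ * b / Y * g x + r * θ * b / Z * e x := fun x => by
    have hfx := hfpos x
    have hgx := hgpos x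
    have hex := hepos x
    have := Real.geom_mean_le_arith_mean3_weighted hb0.le (by positivity : 0 ≤ q * θ * b)
      (by positivity : 0 ≤ r * θ * b) (by positivity : 0 ≤ f x ^ θ / S)
      (by positivity : 0 ≤ g x / Y) (by positivity : 0 ≤ e x / Z) hsum
    rw [Real.div_rpow (by positivity) hS.le, Real.div_rpow hgx.le hY.le,
      Real.div_rpow hex.le hZ.le, div_mul_div_comm, div_mul_div_comm, hpow hfx hgx hex,
      hone x, Real.one_rpow, one_div] at this
    exact this.trans_eq (by ring)
  have hmean := integral_mono (μ := μ) (integrable_const _)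
    (((hfθ.const_mul (b / S)).add (hg.const_mul (q * θ * b / Y))).add
      (he.const_mul (r * θ * b / Z))) hpt
  rw [integral_add' ((hfθ.const_mul _).add (hg.const_mul _)) (he.const_mul _),
    integral_add' (hfθ.const_mul _) (hg.const_mul _), integral_const_mul, integral_const_mul,
    integral_const_mul, ← hSdef, ← hYdef, ← hZdef, div_mul_cancel₀ _ hS.ne',
    div_mul_cancel₀ _ hY.ne', div_mul_cancel₀ _ hZ.ne', hsum] at hmean
  simp only [integral_const, probReal_univ, one_smul] at hmean
  have h3 : 1 ≤ (S * (Y ^ q * Z ^ r) ^ θ) ^ b := by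
    have h4 := (inv_le_one₀ (by positivity)).1 hmean
    refine h4.trans_eq ?_
    rw [Real.mul_rpow hS.le (by positivity), ← Real.rpow_mul (by positivity),
      Real.mul_rpow (by positivity) (by positivity), ← Real.rpow_mul hY.le,
      ← Real.rpow_mul hZ.le]
    ring_nf
  by_contra! hlt
  exact absurd h3 (not_le.2 (Real.rpow_lt_one (by positivity) hlt hb0))

end Probability

open Filter Topology Metric in
lemma ae_tendsto_boxMean {f : (Fin n → ℝ) → ℝ} (hf : LocallyIntegrable f) :
    ∀ᵐ x, ∀ (c : ℕ → Fin n → ℝ) (h : ℝ), 0 < h → (∀ k, x ∈ halfOpenBox (c k) (h / 2 ^ k)) →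
      Tendsto (fun k => boxMean f (c k) (h / 2 ^ k)) atTop (𝓝 (f x)) := by
  filter_upwards [IsUnifLocDoublingMeasure.ae_tendsto_average volume hf 1] with x hx c h hh hmem
  have hball : ∀ k, closedBall (fun i => c k i + h / 2 ^ k / 2) (h / 2 ^ k / 2) =
      univ.pi fun i => Icc (c k i) (c k i + h / 2 ^ k) := fun k => by
    rw [closedBall_pi _ (by positivity)]
    congr! 2 with i
    rw [Real.closedBall_eq_Icc]
    congr 1 <;> ring
  have := hx (l := atTop) (fun k i => c k i + h / 2 ^ k / 2) (fun k => h / 2 ^ k / 2) ?_ ?_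
  · refine this.congr fun k => ?_
    have hae : halfOpenBox (c k) (h / 2 ^ k) =ᵐ[volume]
        univ.pi fun i => Icc (c k i) (c k i + h / 2 ^ k) :=
      by
      rw [pi_univ_Icc]
      exact Measure.univ_pi_Ico_ae_eq_Icc
    rw [hball, setAverage_eq, measureReal_def, ← measure_congr hae, setIntegral_congr_set hae.symm,
      volume_halfOpenBox _ (by positivity), ENNReal.toReal_ofReal (by positivity), boxMean,
      smul_eq_mul, inv_mul_eq_div]
  · refine tendsto_nhdsWithin_iff.2 ⟨?_, .of_forall fun k => mem_Ioi.2 (by positivity)⟩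
    have : Tendsto (fun k : ℕ => h / 2 * (1 / 2 : ℝ) ^ k) atTop (𝓝 (h / 2 * 0)) :=
      (tendsto_pow_atTop_nhds_zero_of_lt_one (by norm_num) (by norm_num)).const_mul _
    rw [mul_zero] at this
    refine this.congr fun k => ?_
    rw [one_div, inv_pow]
    ring
  · refine .of_forall fun k => ?_
    rw [one_mul, hball]
    exact fun i _ => Ico_subset_Icc_self (hmem k i (mem_univ i))

/-- A function which, on a box, dominates the value of `F` on one of the dyadic subboxes of
generation `k` containing the given point. -/
noncomputable def dyadicSample (F : (Fin n → ℝ) → ℝ → ℝ≥0∞) :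
    ℕ → (Fin n → ℝ) → ℝ → (Fin n → ℝ) → ℝ≥0∞
  | 0, a, h => fun _ => F a h
  | k + 1, a, h => fun x => ∑ ε, (halfOpenBox (childCorner a h ε) (h / 2)).indicator
      (dyadicSample F k (childCorner a h ε) (h / 2)) x

lemma measurable_dyadicSample (F : (Fin n → ℝ) → ℝ → ℝ≥0∞) (k : ℕ) (a : Fin n → ℝ) (h : ℝ) :
    Measurable (dyadicSample F k a h) := by
  induction k generalizing a h with
  | zero => exact measurable_const
  | succ k ih =>
    exact Finset.measurable_fun_sum _ fun ε _ =>
      (ih _ _).indicator (measurableSet_halfOpenBox _ _)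

lemma exists_le_dyadicSample (F : (Fin n → ℝ) → ℝ → ℝ≥0∞) (k : ℕ) {a : Fin n → ℝ} {h : ℝ}
    (hh : 0 < h) {x : Fin n → ℝ} (hx : x ∈ halfOpenBox a h) :
    ∃ c, x ∈ halfOpenBox c (h / 2 ^ k) ∧ F c (h / 2 ^ k) ≤ dyadicSample F k a h x := by
  induction k generalizing a h with
  | zero => exact ⟨a, by simpa using hx, by simp [dyadicSample]⟩
  | succ k ih =>
    rw [← iUnion_childBox a hh, mem_iUnion] at hx
    obtain ⟨ε, hε⟩ := hx
    obtain ⟨c, hc, hle⟩ := ih (half_pos hh) hε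
    rw [pow_succ', ← div_div]
    refine ⟨c, hc, hle.trans ?_⟩
    rw [dyadicSample]
    refine le_trans (by rw [indicator_of_mem hε]) (Finset.single_le_sum
      (f := fun ε => (halfOpenBox (childCorner a h ε) (h / 2)).indicator
        (dyadicSample F k (childCorner a h ε) (h / 2)) x) (fun _ _ => zero_le)
      (Finset.mem_univ ε))

lemma lintegral_dyadicSample_le {F G : (Fin n → ℝ) → ℝ → ℝ≥0∞}
    (hFG : ∀ a h, 0 < h → F a h * volume (halfOpenBox a h) ≤ G a h)
    (hG : ∀ a h, 0 < h → ∑ ε, G (childCorner a h ε) (h / 2) ≤ G a h)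
    (k : ℕ) {a : Fin n → ℝ} {h : ℝ} (hh : 0 < h) :
    ∫⁻ x in halfOpenBox a h, dyadicSample F k a h x ≤ G a h := by
  induction k generalizing a h with
  | zero => simpa [dyadicSample] using hFG a h hh
  | succ k ih =>
    refine le_trans ?_ (hG a h hh)
    simp only [dyadicSample]
    rw [lintegral_finsetSum _ fun ε _ => (measurable_dyadicSample F k _ _).indicator
      (measurableSet_halfOpenBox _ _)]
    refine Finset.sum_le_sum fun ε _ => le_trans ?_ (ih (half_pos hh))
    rw [lintegral_indicator (measurableSet_halfOpenBox _ _),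
      Measure.restrict_restrict (measurableSet_halfOpenBox _ _)]
    exact lintegral_mono' (Measure.restrict_mono inter_subset_left le_rfl) le_rfl

open ProbabilityTheory in
lemma boxMean_eq_integral_cond (f : (Fin n → ℝ) → ℝ) (a : Fin n → ℝ) {h : ℝ} (hh : 0 < h) :
    boxMean f a h = ∫ x, f x ∂volume[|halfOpenBox a h] := by
  rw [ProbabilityTheory.cond, integral_smul_measure, volume_halfOpenBox a hh, ENNReal.toReal_inv,
    ENNReal.toReal_ofReal (by positivity), boxMean, smul_eq_mul, inv_mul_eq_div]

open ProbabilityTheory in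
lemma isProbabilityMeasure_cond_halfOpenBox (a : Fin n → ℝ) {h : ℝ} (hh : 0 < h) :
    IsProbabilityMeasure volume[|halfOpenBox a h] :=
  cond_isProbabilityMeasure_of_finite
    (by rw [volume_halfOpenBox a hh]; simpa using pow_pos hh n)
    (by rw [volume_halfOpenBox a hh]; exact ENNReal.ofReal_ne_top)

open ProbabilityTheory in
lemma integrable_cond_halfOpenBox {f : (Fin n → ℝ) → ℝ} {a : Fin n → ℝ} {h : ℝ} (hh : 0 < h)
    (hf : IntegrableOn f (halfOpenBox a h)) : Integrable f volume[|halfOpenBox a h] :=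
  hf.smul_measure (by rw [volume_halfOpenBox a hh]; simpa using pow_pos hh n)

lemma integrableOn_rpow_halfOpenBox {f : (Fin n → ℝ) → ℝ} {a : Fin n → ℝ} {h θ : ℝ}
    (hh : 0 < h) (hf : IntegrableOn f (halfOpenBox a h)) (hpos : ∀ x, 0 < f x)
    (h0 : 0 ≤ θ) (h1 : θ ≤ 1) : IntegrableOn (fun x => f x ^ θ) (halfOpenBox a h) := by
  have : IsFiniteMeasure (volume.restrict (halfOpenBox a h)) :=
    ⟨by rw [Measure.restrict_apply_univ, volume_halfOpenBox a hh]; exact ENNReal.ofReal_lt_top⟩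
  exact integrable_rpow_of_le_one hf hpos h0 h1

lemma boxMean_pos {f : (Fin n → ℝ) → ℝ} {a : Fin n → ℝ} {h : ℝ} (hh : 0 < h)
    (hf : IntegrableOn f (halfOpenBox a h)) (hpos : ∀ x, 0 < f x) : 0 < boxMean f a h := by
  have := isProbabilityMeasure_cond_halfOpenBox a hh
  rw [boxMean_eq_integral_cond f a hh]
  exact integral_pos_of_forall_pos (integrable_cond_halfOpenBox hh hf) hpos

lemma locallyIntegrable_of_integrableOn_halfOpenBox {f : (Fin n → ℝ) → ℝ}
    (hf : ∀ a h, 0 < h → IntegrableOn f (halfOpenBox a h)) : LocallyIntegrable f := by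
  intro x
  refine ⟨_, ?_, hf (fun i => x i - 1) 2 two_pos⟩
  refine set_pi_mem_nhds finite_univ fun i _ => Ico_mem_nhds ?_ ?_ <;> linarith

lemma pow_boxMean_rpow_le {f : (Fin n → ℝ) → ℝ} {a : Fin n → ℝ} {h δ : ℝ} (hh : 0 < h)
    (hf : IntegrableOn f (halfOpenBox a h)) (hpos : ∀ x, 0 < f x) (hδ0 : 0 ≤ δ) (hδ1 : δ ≤ 1) :
    boxMean (fun x => f x ^ ((2 + δ) / 4)) a h ^ 4 ≤ boxMean f a h ^ (2 + δ) := by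
  have := isProbabilityMeasure_cond_halfOpenBox a hh
  have hX := boxMean_pos hh hf hpos
  have hS := boxMean_pos hh (integrableOn_rpow_halfOpenBox hh hf hpos (θ := (2 + δ) / 4)
    (by linarith) (by linarith)) fun x => Real.rpow_pos_of_pos (hpos x) _
  have hle : boxMean (fun x => f x ^ ((2 + δ) / 4)) a h ≤ boxMean f a h ^ ((2 + δ) / 4) := by
    simp only [boxMean_eq_integral_cond _ a hh]
    exact integral_rpow_le_rpow_integral (integrable_cond_halfOpenBox hh hf) hpos
      (by linarith) (by linarith)
  refine (pow_le_pow_left₀ hS.le hle 4).trans_eq ?_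
  rw [← Real.rpow_mul_natCast hX.le]
  congr 1
  push_cast
  ring

lemma le_pow_boxMean_rpow {f g e : (Fin n → ℝ) → ℝ} {a : Fin n → ℝ} {h δ q r C : ℝ} (hh : 0 < h)
    (hf : IntegrableOn f (halfOpenBox a h)) (hg : IntegrableOn g (halfOpenBox a h))
    (he : IntegrableOn e (halfOpenBox a h))
    (hfpos : ∀ x, 0 < f x) (hgpos : ∀ x, 0 < g x) (hepos : ∀ x, 0 < e x)
    (hq : 0 < q) (hr : 0 < r) (hδ0 : 0 ≤ δ) (hδ1 : δ ≤ 1) (hC1 : 1 ≤ C)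
    (hone : ∀ x, f x * g x ^ q * e x ^ r = 1)
    (hC : boxMean f a h * boxMean g a h ^ q * boxMean e a h ^ r ≤ C) :
    boxMean f a h ^ (2 + δ) ≤ C ^ 3 * boxMean (fun x => f x ^ ((2 + δ) / 4)) a h ^ 4 := by
  have := isProbabilityMeasure_cond_halfOpenBox a hh
  have hX := boxMean_pos hh hf hfpos
  have hY := boxMean_pos hh hg hgpos
  have hZ := boxMean_pos hh he hepos
  have hS := boxMean_pos hh (integrableOn_rpow_halfOpenBox hh hf hfpos (θ := (2 + δ) / 4)
    (by linarith) (by linarith)) fun x => Real.rpow_pos_of_pos (hfpos x) _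
  have h1 := one_le_integral_rpow_mul (integrable_cond_halfOpenBox hh hf)
    (integrable_cond_halfOpenBox hh hg) (integrable_cond_halfOpenBox hh he) hfpos hgpos hepos
    hq hr (θ := (2 + δ) / 4) (by linarith) (by linarith) hone
  simp only [← boxMean_eq_integral_cond _ a hh] at h1
  set X := boxMean f a h
  set T := boxMean g a h ^ q * boxMean e a h ^ r with hT
  set S := boxMean (fun x => f x ^ ((2 + δ) / 4)) a h
  have hT0 : 0 < T := by positivity
  rw [mul_assoc, ← hT] at hC
  have h4 : 1 ≤ S ^ 4 * T ^ (2 + δ) := by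
    have := one_le_pow₀ h1 (n := 4)
    rwa [mul_pow, ← Real.rpow_mul_natCast hT0.le, Nat.cast_ofNat,
      div_mul_cancel₀ _ (four_ne_zero)] at this
  calc X ^ (2 + δ) = X ^ (2 + δ) * 1 := (mul_one _).symm
    _ ≤ X ^ (2 + δ) * (S ^ 4 * T ^ (2 + δ)) := by gcongr
    _ = (X * T) ^ (2 + δ) * S ^ 4 := by rw [Real.mul_rpow hX.le hT0.le]; ring
    _ ≤ C ^ (2 + δ) * S ^ 4 := by gcongr
    _ ≤ C ^ (3 : ℝ) * S ^ 4 := by gcongr; linarith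
    _ = C ^ 3 * S ^ 4 := by norm_cast

open Filter Topology in
/-- A reverse Hölder inequality on boxes. -/
theorem lintegral_rpow_one_add_le {f g e : (Fin n → ℝ) → ℝ} {δ q r C : ℝ}
    (hf : ∀ a h, 0 < h → IntegrableOn f (halfOpenBox a h))
    (hg : ∀ a h, 0 < h → IntegrableOn g (halfOpenBox a h))
    (he : ∀ a h, 0 < h → IntegrableOn e (halfOpenBox a h))
    (hfpos : ∀ x, 0 < f x) (hgpos : ∀ x, 0 < g x) (hepos : ∀ x, 0 < e x)
    (hq : 0 < q) (hr : 0 < r) (hδ0 : 0 < δ) (hδ1 : δ ≤ 1) (hC1 : 1 ≤ C)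
    (hone : ∀ x, f x * g x ^ q * e x ^ r = 1)
    (hC : ∀ a h, 0 < h → boxMean f a h * boxMean g a h ^ q * boxMean e a h ^ r ≤ C)
    (hδ : 4 * δ * (2 ^ n + 1) ^ 2 * C ^ 3 ≤ 1) (a : Fin n → ℝ) {h : ℝ} (hh : 0 < h) :
    ∫⁻ x in halfOpenBox a h, ENNReal.ofReal (f x ^ (1 + δ)) ≤
      ENNReal.ofReal (2 * boxMean f a h ^ (1 + δ)) * volume (halfOpenBox a h) := by
  set s : (Fin n → ℝ) → ℝ → ℝ := boxMean fun x => f x ^ ((2 + δ) / 4) with hs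
  set F : (Fin n → ℝ) → ℝ → ℝ≥0∞ := fun a h => ENNReal.ofReal (boxMean f a h ^ (1 + δ))
  set P : (Fin n → ℝ) → ℝ → ℝ := fun a h => 2 * boxMean f a h ^ (1 + δ) - s a h ^ 4 / boxMean f a h
  set G : (Fin n → ℝ) → ℝ → ℝ≥0∞ := fun a h => ENNReal.ofReal (P a h * h ^ n)
  have hx0 : ∀ a h, 0 < h → 0 < boxMean f a h := fun a h hh => boxMean_pos hh (hf a h hh) hfpos
  have hfθ : ∀ a h, 0 < h → IntegrableOn (fun x => f x ^ ((2 + δ) / 4)) (halfOpenBox a h) :=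
    fun a h hh => integrableOn_rpow_halfOpenBox hh (hf a h hh) hfpos (by linarith) (by linarith)
  have hs0 : ∀ a h, 0 < h → 0 < s a h := fun a h hh =>
    boxMean_pos hh (hfθ a h hh) fun x => Real.rpow_pos_of_pos (hfpos x) _
  have hPge : ∀ a h, 0 < h → boxMean f a h ^ (1 + δ) ≤ P a h := fun a h hh => by
    have h1 : s a h ^ 4 / boxMean f a h ≤ boxMean f a h ^ (1 + δ) := by
      rw [div_le_iff₀ (hx0 a h hh)]
      refine (pow_boxMean_rpow_le hh (hf a h hh) hfpos hδ0.le hδ1).trans_eq ?_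
      rw [← Real.rpow_add_one (hx0 a h hh).ne']
      ring_nf
    simp only [P]
    linarith
  have hP0 : ∀ a h, 0 < h → 0 ≤ P a h := fun a h hh =>
    (Real.rpow_nonneg (hx0 a h hh).le _).trans (hPge a h hh)
  have hFG : ∀ a h, 0 < h → F a h * volume (halfOpenBox a h) ≤ G a h := fun a h hh => by
    rw [volume_halfOpenBox a hh, ← ENNReal.ofReal_mul (Real.rpow_nonneg (hx0 a h hh).le _)]
    exact ENNReal.ofReal_le_ofReal (mul_le_mul_of_nonneg_right (hPge a h hh) (by positivity))
  have hGsum : ∀ a h, 0 < h → ∑ ε, G (childCorner a h ε) (h / 2) ≤ G a h := fun a h hh => by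
    have hh2 := half_pos hh
    rw [← ENNReal.ofReal_sum_of_nonneg fun ε _ => mul_nonneg (hP0 _ _ hh2) (by positivity)]
    refine ENNReal.ofReal_le_ofReal ?_
    rw [← Finset.sum_mul]
    have hk : 4 * δ * (Fintype.card (Fin n → Bool) + 1 : ℝ) ^ 2 * boxMean f a h ^ (2 + δ) ≤
        s a h ^ 4 := by
      have hlow := le_pow_boxMean_rpow hh (hf a h hh) (hg a h hh) (he a h hh) hfpos hgpos hepos
        hq hr hδ0.le hδ1 hC1 hone (hC a h hh)
      have hcard : (Fintype.card (Fin n → Bool) : ℝ) = 2 ^ n := by simp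
      rw [hcard]
      calc 4 * δ * (2 ^ n + 1 : ℝ) ^ 2 * boxMean f a h ^ (2 + δ)
          ≤ 4 * δ * (2 ^ n + 1 : ℝ) ^ 2 * (C ^ 3 * s a h ^ 4) := by gcongr
        _ = 4 * δ * (2 ^ n + 1 : ℝ) ^ 2 * C ^ 3 * s a h ^ 4 := by ring
        _ ≤ 1 * s a h ^ 4 := by gcongr
        _ = s a h ^ 4 := one_mul _
    have hstep := bellman_step hδ0 hδ1 (fun ε => hx0 (childCorner a h ε) _ hh2)
      (fun ε => hs0 (childCorner a h ε) _ hh2) (sum_boxMean_child hh (hf a h hh))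
      (sum_boxMean_child hh (hfθ a h hh)) hk
    refine (mul_le_mul_of_nonneg_right hstep (by positivity)).trans_eq ?_
    simp only [P, ← hs, div_pow]
    simp
    field_simp
  have hae : ∀ᵐ x, x ∈ halfOpenBox a h → ENNReal.ofReal (f x ^ (1 + δ)) ≤
      liminf (fun k => dyadicSample F k a h x) atTop := by
    filter_upwards [ae_tendsto_boxMean (locallyIntegrable_of_integrableOn_halfOpenBox hf)]
      with x hx hxa
    choose c hc hle using fun k => exists_le_dyadicSample F k hh hxa
    have hlim : Tendsto (fun k => F (c k) (h / 2 ^ k)) atTop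
        (𝓝 (ENNReal.ofReal (f x ^ (1 + δ)))) :=
      ENNReal.tendsto_ofReal ((hx c h hh hc).rpow_const (.inl (hfpos x).ne'))
    rw [← hlim.liminf_eq]
    exact liminf_le_liminf (.of_forall hle)
  calc ∫⁻ x in halfOpenBox a h, ENNReal.ofReal (f x ^ (1 + δ))
      ≤ ∫⁻ x in halfOpenBox a h, liminf (fun k => dyadicSample F k a h x) atTop :=
        setLIntegral_mono_ae' (measurableSet_halfOpenBox a h) hae
    _ ≤ liminf (fun k => ∫⁻ x in halfOpenBox a h, dyadicSample F k a h x) atTop :=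
        lintegral_liminf_le fun k => measurable_dyadicSample F k a h
    _ ≤ G a h := liminf_le_of_frequently_le'
        (.of_forall fun k => lintegral_dyadicSample_le hFG hGsum k hh)
    _ ≤ ENNReal.ofReal (2 * boxMean f a h ^ (1 + δ)) * volume (halfOpenBox a h) := by
        have hxa := hx0 a h hh
        rw [volume_halfOpenBox a hh, ← ENNReal.ofReal_mul (by positivity)]
        refine ENNReal.ofReal_le_ofReal (mul_le_mul_of_nonneg_right ?_ (by positivity))
        have : 0 ≤ s a h ^ 4 / boxMean f a h := by positivity
        simp only [P]
        linarith

/-- The mean of a function over a half-open box as an extended nonnegative number. -/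
noncomputable def boxLMean (f : (Fin n → ℝ) → ℝ) (a : Fin n → ℝ) (h : ℝ) : ℝ≥0∞ :=
  (volume (halfOpenBox a h))⁻¹ * ∫⁻ x in halfOpenBox a h, ENNReal.ofReal (f x)

lemma boxLMean_ne_zero {f : (Fin n → ℝ) → ℝ} (hm : Measurable f) (hpos : ∀ x, 0 < f x)
    (a : Fin n → ℝ) {h : ℝ} (hh : 0 < h) :
    boxLMean f a h ≠ 0 := by
  have hvol : volume (halfOpenBox a h) ≠ 0 := by
    rw [volume_halfOpenBox a hh]
    simpa using pow_pos hh n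
  refine mul_ne_zero (ENNReal.inv_ne_zero.2 ?_) ?_
  · rw [volume_halfOpenBox a hh]
    exact ENNReal.ofReal_ne_top
  · refine ((setLIntegral_pos_iff hm.ennreal_ofReal).2 ?_).ne'
    rw [Function.support_eq_univ fun x => (ENNReal.ofReal_pos.2 (hpos x)).ne', univ_inter]
    exact pos_iff_ne_zero.2 hvol

lemma integrableOn_of_boxLMean_ne_top {f : (Fin n → ℝ) → ℝ} (hm : Measurable f)
    (hpos : ∀ x, 0 < f x) {a : Fin n → ℝ} {h : ℝ} (hh : 0 < h) (hf : boxLMean f a h ≠ ⊤) :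
    IntegrableOn f (halfOpenBox a h) := by
  refine (lintegral_ofReal_ne_top_iff_integrable hm.aestronglyMeasurable
    (.of_forall fun x => (hpos x).le)).1 fun htop => hf ?_
  rw [boxLMean, htop, ENNReal.mul_top]
  rw [volume_halfOpenBox a hh]
  exact ENNReal.inv_ne_zero.2 ENNReal.ofReal_ne_top

lemma boxLMean_eq_ofReal {f : (Fin n → ℝ) → ℝ} (hpos : ∀ x, 0 < f x) {a : Fin n → ℝ} {h : ℝ}
    (hh : 0 < h) (hf : IntegrableOn f (halfOpenBox a h)) :
    boxLMean f a h = ENNReal.ofReal (boxMean f a h) := by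
  rw [boxLMean, ← ofReal_integral_eq_lintegral_ofReal hf (.of_forall fun x => (hpos x).le),
    volume_halfOpenBox a hh, ← ENNReal.ofReal_inv_of_pos (by positivity),
    ← ENNReal.ofReal_mul (by positivity), inv_mul_eq_div, boxMean]

lemma boxLMean_le_of_lintegral_le {f : (Fin n → ℝ) → ℝ} {a : Fin n → ℝ} {h : ℝ} {c : ℝ≥0∞}
    (hf : ∫⁻ x in halfOpenBox a h, ENNReal.ofReal (f x) ≤ c * volume (halfOpenBox a h)) :
    boxLMean f a h ≤ c := by
  rw [boxLMean, mul_comm, ← div_eq_mul_inv]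
  exact ENNReal.div_le_of_le_mul hf

lemma preimage_toLp_axisCube (a : Fin n → ℝ) (h : ℝ) :
    WithLp.toLp 2 ⁻¹' axisCube n a h = Icc a fun i => a i + h := by
  ext x
  simp [axisCube, Pi.le_def, forall_and]

lemma halfOpenBox_ae_eq_Icc (a : Fin n → ℝ) (h : ℝ) :
    halfOpenBox a h =ᵐ[volume] Icc a fun i => a i + h :=
  Measure.univ_pi_Ico_ae_eq_Icc

lemma measurableSet_axisCube (a : Fin n → ℝ) (h : ℝ) : MeasurableSet (axisCube n a h) := by
  rw [← (MeasurableEquiv.toLp 2 (Fin n → ℝ)).measurableSet_preimage]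
  exact (preimage_toLp_axisCube a h).symm ▸ measurableSet_Icc

lemma inv_volume_axisCube_mul_lintegral (f : EuclideanSpace ℝ (Fin n) → ℝ) (a : Fin n → ℝ)
    (h : ℝ) : (volume (axisCube n a h))⁻¹ * ∫⁻ x in axisCube n a h, ENNReal.ofReal (f x) =
      boxLMean (fun x => f (WithLp.toLp 2 x)) a h := by
  have hmp := PiLp.volume_preserving_toLp (Fin n)
  rw [boxLMean, setLIntegral_congr (halfOpenBox_ae_eq_Icc a h),
    measure_congr (halfOpenBox_ae_eq_Icc a h), ← preimage_toLp_axisCube,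
    hmp.measure_preimage (measurableSet_axisCube a h).nullMeasurableSet,
    hmp.setLIntegral_comp_preimage_emb (MeasurableEquiv.toLp 2 (Fin n → ℝ)).measurableEmbedding
      (fun x => ENNReal.ofReal (f x))]

theorem exists_boxLMean_rpow_one_add_le {f g e : (Fin n → ℝ) → ℝ}
    (hfm : Measurable f) (hgm : Measurable g) (hem : Measurable e)
    (hfpos : ∀ x, 0 < f x) (hgpos : ∀ x, 0 < g x) (hepos : ∀ x, 0 < e x)
    (hone : ∀ x, f x * g x ^ (1 / 2 : ℝ) * e x ^ (1 / 2 : ℝ) = 1) {B : ℝ≥0∞} (hB : B ≠ ⊤)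
    (hA : ∀ a h, 0 < h →
      boxLMean f a h * boxLMean g a h ^ (1 / 2 : ℝ) * boxLMean e a h ^ (1 / 2 : ℝ) ≤ B) :
    ∃ δ : ℝ, 0 < δ ∧ ∃ B' : ℝ≥0∞, B' ≠ ⊤ ∧ ∀ a h, 0 < h →
      boxLMean (fun x => f x ^ (1 + δ)) a h *
        boxLMean (fun x => g x ^ (1 + δ)) a h ^ (1 / 2 : ℝ) *
        boxLMean (fun x => e x ^ (1 + δ)) a h ^ (1 / 2 : ℝ) ≤ B' := by
  have hhalf : (0 : ℝ) < 1 / 2 := by norm_num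
  have hne : ∀ {k : (Fin n → ℝ) → ℝ}, Measurable k → (∀ x, 0 < k x) → ∀ a h, 0 < h →
      boxLMean k a h ^ (1 / 2 : ℝ) ≠ 0 := fun hm hpos a h hh => by
    simpa using boxLMean_ne_zero hm hpos a hh
  have htop : ∀ a h, 0 < h →
      boxLMean f a h * boxLMean g a h ^ (1 / 2 : ℝ) * boxLMean e a h ^ (1 / 2 : ℝ) ≠ ⊤ :=
    fun a h hh => ne_top_of_le_ne_top hB (hA a h hh)
  have hfg : ∀ a h, 0 < h → boxLMean f a h * boxLMean g a h ^ (1 / 2 : ℝ) ≠ ⊤ := fun a h hh =>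
    (ENNReal.lt_top_of_mul_ne_top_left (htop a h hh) (hne hem hepos a h hh)).ne
  have hfi : ∀ a h, 0 < h → IntegrableOn f (halfOpenBox a h) := fun a h hh =>
    integrableOn_of_boxLMean_ne_top hfm hfpos hh
      (ENNReal.lt_top_of_mul_ne_top_left (hfg a h hh) (hne hgm hgpos a h hh)).ne
  have hgi : ∀ a h, 0 < h → IntegrableOn g (halfOpenBox a h) := fun a h hh =>
    integrableOn_of_boxLMean_ne_top hgm hgpos hh fun hg => by
      refine (ENNReal.lt_top_of_mul_ne_top_right (hfg a h hh)
        (boxLMean_ne_zero hfm hfpos a hh)).ne ?_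
      rw [hg, ENNReal.top_rpow_of_pos hhalf]
  have hei : ∀ a h, 0 < h → IntegrableOn e (halfOpenBox a h) := fun a h hh =>
    integrableOn_of_boxLMean_ne_top hem hepos hh fun he => by
      refine (ENNReal.lt_top_of_mul_ne_top_right (htop a h hh)
        (mul_ne_zero (boxLMean_ne_zero hfm hfpos a hh) (hne hgm hgpos a h hh))).ne ?_
      rw [he, ENNReal.top_rpow_of_pos hhalf]
  have hf0 : ∀ a h, 0 < h → 0 < boxMean f a h := fun a h hh => boxMean_pos hh (hfi a h hh) hfpos
  have hg0 : ∀ a h, 0 < h → 0 < boxMean g a h := fun a h hh => boxMean_pos hh (hgi a h hh) hgpos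
  have he0 : ∀ a h, 0 < h → 0 < boxMean e a h := fun a h hh => boxMean_pos hh (hei a h hh) hepos
  set D : ℝ := max 1 B.toReal
  have hD1 : 1 ≤ D := le_max_left _ _
  have hD2 : D ≤ D ^ 2 := by nlinarith
  have hA' : ∀ a h, 0 < h →
      boxMean f a h * boxMean g a h ^ (1 / 2 : ℝ) * boxMean e a h ^ (1 / 2 : ℝ) ≤ D := by
    intro a h hh
    have hf0 := hf0 a h hh
    have hg0 := hg0 a h hh
    have he0 := he0 a h hh
    have := hA a h hh
    rw [boxLMean_eq_ofReal hfpos hh (hfi a h hh), boxLMean_eq_ofReal hgpos hh (hgi a h hh),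
      boxLMean_eq_ofReal hepos hh (hei a h hh), ENNReal.ofReal_rpow_of_pos hg0,
      ENNReal.ofReal_rpow_of_pos he0, ← ENNReal.ofReal_mul hf0.le,
      ← ENNReal.ofReal_mul (by positivity), ENNReal.ofReal_le_iff_le_toReal hB] at this
    exact this.trans (le_max_right _ _)
  have hsq : ∀ {x y z : ℝ}, 0 < x → 0 < y → 0 < z →
      y * x ^ (2 : ℝ) * z ^ (1 : ℝ) = (x * y ^ (1 / 2 : ℝ) * z ^ (1 / 2 : ℝ)) ^ 2 := by
    intro x y z hx hy hz
    rw [mul_pow, mul_pow, ← Real.rpow_mul_natCast hy.le, ← Real.rpow_mul_natCast hz.le]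
    simp only [Real.rpow_one, Real.rpow_two, Nat.cast_ofNat, one_div,
      inv_mul_cancel₀ (two_ne_zero' ℝ)]
    ring
  have hone_g : ∀ x, g x * f x ^ (2 : ℝ) * e x ^ (1 : ℝ) = 1 := fun x => by
    rw [hsq (hfpos x) (hgpos x) (hepos x), hone x, one_pow]
  have hone_e : ∀ x, e x * f x ^ (2 : ℝ) * g x ^ (1 : ℝ) = 1 := fun x => by
    rw [hsq (hfpos x) (hepos x) (hgpos x), mul_right_comm, hone x, one_pow]
  have hA_g : ∀ a h, 0 < h →
      boxMean g a h * boxMean f a h ^ (2 : ℝ) * boxMean e a h ^ (1 : ℝ) ≤ D ^ 2 := fun a h hh => by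
    have hf0 := hf0 a h hh
    have hg0 := hg0 a h hh
    have he0 := he0 a h hh
    rw [hsq hf0 hg0 he0]
    exact pow_le_pow_left₀ (by positivity) (hA' a h hh) 2
  have hA_e : ∀ a h, 0 < h →
      boxMean e a h * boxMean f a h ^ (2 : ℝ) * boxMean g a h ^ (1 : ℝ) ≤ D ^ 2 := fun a h hh => by
    have hf0 := hf0 a h hh
    have hg0 := hg0 a h hh
    have he0 := he0 a h hh
    rw [hsq hf0 he0 hg0, mul_right_comm]
    exact pow_le_pow_left₀ (by positivity) (hA' a h hh) 2
  set K : ℝ := 4 * (2 ^ n + 1) ^ 2 * (D ^ 2) ^ 3 with hK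
  have hK1 : 1 ≤ K := by
    have h1 : (1 : ℝ) ≤ (2 ^ n + 1) ^ 2 := one_le_pow₀ (by linarith [pow_pos (two_pos (α := ℝ)) n])
    have h2 : 1 ≤ (D ^ 2) ^ 3 := one_le_pow₀ (hD1.trans hD2)
    nlinarith
  have hδ0 : 0 < K⁻¹ := by positivity
  have hδ1 : K⁻¹ ≤ 1 := inv_le_one_of_one_le₀ hK1
  have hδK : 4 * K⁻¹ * (2 ^ n + 1) ^ 2 * (D ^ 2) ^ 3 ≤ 1 := by
    refine le_of_eq ?_
    calc 4 * K⁻¹ * (2 ^ n + 1) ^ 2 * (D ^ 2) ^ 3 = K⁻¹ * K := by rw [hK]; ring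
      _ = 1 := inv_mul_cancel₀ (by positivity)
  refine ⟨K⁻¹, hδ0, ENNReal.ofReal (4 * D ^ (1 + K⁻¹)), ENNReal.ofReal_ne_top, fun a h hh => ?_⟩
  have hf_rh := boxLMean_le_of_lintegral_le <| lintegral_rpow_one_add_le hfi hgi hei hfpos hgpos
    hepos hhalf hhalf hδ0 hδ1 (hD1.trans hD2) hone (fun a h hh => (hA' a h hh).trans hD2) hδK a hh
  have hg_rh := boxLMean_le_of_lintegral_le <| lintegral_rpow_one_add_le hgi hfi hei hgpos hfpos
    hepos two_pos one_pos hδ0 hδ1 (hD1.trans hD2) hone_g hA_g hδK a hh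
  have he_rh := boxLMean_le_of_lintegral_le <| lintegral_rpow_one_add_le hei hfi hgi hepos hfpos
    hgpos two_pos one_pos hδ0 hδ1 (hD1.trans hD2) hone_e hA_e hδK a hh
  have hAa := hA' a h hh
  have hX := hf0 a h hh
  have hY := hg0 a h hh
  have hZ := he0 a h hh
  set X := boxMean f a h
  set Y := boxMean g a h
  set Z := boxMean e a h
  set p : ℝ := 1 + K⁻¹
  have hp : 0 ≤ p := by positivity
  calc _ ≤ ENNReal.ofReal (2 * X ^ p) * ENNReal.ofReal (2 * Y ^ p) ^ (1 / 2 : ℝ) *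
        ENNReal.ofReal (2 * Z ^ p) ^ (1 / 2 : ℝ) := by gcongr
    _ = ENNReal.ofReal (2 * X ^ p * (2 * Y ^ p) ^ (1 / 2 : ℝ) * (2 * Z ^ p) ^ (1 / 2 : ℝ)) := by
        rw [ENNReal.ofReal_rpow_of_pos (by positivity), ENNReal.ofReal_rpow_of_pos (by positivity),
          ← ENNReal.ofReal_mul (by positivity), ← ENNReal.ofReal_mul (by positivity)]
    _ = ENNReal.ofReal (4 * (X * Y ^ (1 / 2 : ℝ) * Z ^ (1 / 2 : ℝ)) ^ p) := by
        have h2 : (2 : ℝ) ^ (1 / 2 : ℝ) * 2 ^ (1 / 2 : ℝ) = 2 := by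
          rw [← Real.rpow_add two_pos]
          norm_num
        congr 1
        rw [Real.mul_rpow two_pos.le (by positivity), Real.mul_rpow two_pos.le (by positivity),
          Real.mul_rpow (by positivity) (by positivity),
          Real.mul_rpow (by positivity) (by positivity), ← Real.rpow_mul hY.le,
          ← Real.rpow_mul hZ.le, ← Real.rpow_mul hY.le, ← Real.rpow_mul hZ.le,
          mul_comm p]
        linear_combination (2 * X ^ p * Y ^ (1 / 2 * p) * Z ^ (1 / 2 * p)) * h2
    _ ≤ ENNReal.ofReal (4 * D ^ p) := by gcongr

end Boxes

theorem bilinear_weight_openness (n : ℕ) (hn : 1 ≤ n)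
    (w₁ w₂ : EuclideanSpace ℝ (Fin n) → ℝ)
    (hw₁ : ∀ x, 0 < w₁ x) (hw₂ : ∀ x, 0 < w₂ x)
    (hm₁ : Measurable w₁) (hm₂ : Measurable w₂)
    (hA : IsBilinearA22 n w₁ w₂) :
    ∃ δ : ℝ, 0 < δ ∧
      IsBilinearA22 n (fun x => w₁ x ^ (1 + δ)) (fun x => w₂ x ^ (1 + δ)) := by
  obtain ⟨B, hB, hA⟩ := hA
  have hφ : Measurable (WithLp.toLp 2 : (Fin n → ℝ) → EuclideanSpace ℝ (Fin n)) :=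
    (MeasurableEquiv.toLp 2 (Fin n → ℝ)).measurable
  simp only [inv_volume_axisCube_mul_lintegral (fun x => (w₁ x * w₂ x) ^ (1 / 2 : ℝ)),
    inv_volume_axisCube_mul_lintegral (fun x => (w₁ x)⁻¹),
    inv_volume_axisCube_mul_lintegral (fun x => (w₂ x)⁻¹)] at hA
  obtain ⟨δ, hδ, B', hB', hA'⟩ := exists_boxLMean_rpow_one_add_le
    (((hm₁.mul hm₂).pow_const (1 / 2 : ℝ)).comp hφ) (hm₁.inv.comp hφ) (hm₂.inv.comp hφ)
    (fun x => Real.rpow_pos_of_pos (mul_pos (hw₁ _) (hw₂ _)) _) (fun x => inv_pos.2 (hw₁ _))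
    (fun x => inv_pos.2 (hw₂ _)) (fun x => by
      have h1 := hw₁ (WithLp.toLp 2 x)
      have h2 := hw₂ (WithLp.toLp 2 x)
      simp only [Function.comp_apply, Pi.mul_apply, Pi.inv_apply]
      rw [← Real.mul_rpow (by positivity) (by positivity),
        ← Real.mul_rpow (by positivity) (by positivity)]
      convert Real.one_rpow (1 / 2)
      field_simp) hB hA
  refine ⟨δ, hδ, B', hB', fun a h hh => ?_⟩
  rw [inv_volume_axisCube_mul_lintegral
      (fun x => (w₁ x ^ (1 + δ) * w₂ x ^ (1 + δ)) ^ (1 / 2 : ℝ)),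
    inv_volume_axisCube_mul_lintegral (fun x => (w₁ x ^ (1 + δ))⁻¹),
    inv_volume_axisCube_mul_lintegral (fun x => (w₂ x ^ (1 + δ))⁻¹)]
  convert hA' a h hh using 5 with x
  · have h1 := (hw₁ (WithLp.toLp 2 x)).le
    have h2 := (hw₂ (WithLp.toLp 2 x)).le
    simp only [Function.comp_apply, Pi.mul_apply]
    rw [← Real.mul_rpow h1 h2, ← Real.rpow_mul (by positivity), ← Real.rpow_mul (by positivity),
      mul_comm (1 + δ)]
  · funext x
    exact (Real.inv_rpow (hw₁ _).le _).symm
  · exact (Real.inv_rpow (hw₂ _).le _).symm
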